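/- Let n ≥ 1. Define ν(A) := (1/2) · sSup { trace(B * A * Bᵀ * J_n) : B real orthogonal 2n×2n } for skew-symmetric real 2n×2n matrices A. Then ν is a norm on the space of skew-symmetric 2n×2n matrices: (i) ν(A + A') ≤ ν(A) + ν(A') for all skew-symmetric A, A'; (ii) ν(c•A) = |c| · ν(A) for all c ∈ ℝ and skew-symmetric A; (iii) if A is skew-symmetric and ν(A) = 0, then A = 0. -/

import Mathlib

open Matrix

/-- The standard complex structure `J_n` on `ℝ^{2n}`: block diagonal with `n`
`2×2` blocks `((0,-1),(1,0))`. -/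
def stdJ (n : ℕ) : Matrix (Fin (2*n)) (Fin (2*n)) ℝ :=
  Matrix.of fun i j =>
    if (i : ℕ) = (j : ℕ) + 1 ∧ (j : ℕ) % 2 = 0 then 1
    else if (j : ℕ) = (i : ℕ) + 1 ∧ (i : ℕ) % 2 = 0 then -1
    else 0

/-- `ν(A) = (1/2) · sup { trace (B * A * Bᵀ * J_n) | B orthogonal }`. -/
noncomputable def nuNorm (n : ℕ) (A : Matrix (Fin (2*n)) (Fin (2*n)) ℝ) : ℝ :=
  (1/2) * sSup {x : ℝ | ∃ B : Matrix (Fin (2*n)) (Fin (2*n)) ℝ,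
    B * Bᵀ = 1 ∧ x = (B * A * Bᵀ * stdJ n).trace}

theorem trace_conj_mul_le {m : Type*} [Fintype m] [DecidableEq m] (A J B : Matrix m m ℝ)
    (hB : B * Bᵀ = 1) :
    (B * A * Bᵀ * J).trace ≤ ∑ i, ∑ j, (∑ k, ∑ l, |A l k|) * |J j i| := by
  have hU : B ∈ Matrix.unitaryGroup m ℝ := by
    rw [Matrix.mem_unitaryGroup_iff]
    simpa [Matrix.star_eq_conjTranspose] using hB
  have hb (i j : m) : |B i j| ≤ 1 := entry_norm_bound_of_unitary hU i j
  rw [Matrix.trace]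
  simp only [Matrix.diag_apply, Matrix.mul_apply (M := B * A * Bᵀ)]
  refine Finset.sum_le_sum fun i _ => Finset.sum_le_sum fun j _ => ?_
  refine (le_abs_self _).trans ?_
  rw [abs_mul]
  refine mul_le_mul_of_nonneg_right ?_ (abs_nonneg _)
  rw [Matrix.mul_apply]
  refine (Finset.abs_sum_le_sum_abs _ _).trans (Finset.sum_le_sum fun k _ => ?_)
  rw [Matrix.mul_apply, abs_mul]
  refine (mul_le_of_le_one_right (abs_nonneg _) (hb j k)).trans ?_
  refine (Finset.abs_sum_le_sum_abs _ _).trans (Finset.sum_le_sum fun l _ => ?_)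
  rw [abs_mul]
  exact mul_le_of_le_one_left (abs_nonneg _) (hb i l)

/-- The values `trace (B * A * Bᵀ * J_n)` for `B` orthogonal. -/
def orbitTraces (n : ℕ) (A : Matrix (Fin (2*n)) (Fin (2*n)) ℝ) : Set ℝ :=
  {x : ℝ | ∃ B : Matrix (Fin (2*n)) (Fin (2*n)) ℝ,
    B * Bᵀ = 1 ∧ x = (B * A * Bᵀ * stdJ n).trace}

theorem nuNorm_eq (n : ℕ) (A : Matrix (Fin (2*n)) (Fin (2*n)) ℝ) :
    nuNorm n A = (1/2) * sSup (orbitTraces n A) := rfl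

theorem orbitTraces_bddAbove (n : ℕ) (A : Matrix (Fin (2*n)) (Fin (2*n)) ℝ) :
    BddAbove (orbitTraces n A) := by
  refine ⟨∑ i, ∑ j, (∑ k, ∑ l, |A l k|) * |stdJ n j i|, ?_⟩
  rintro x ⟨B, hB, rfl⟩
  exact trace_conj_mul_le A (stdJ n) B hB

theorem orbitTraces_nonempty (n : ℕ) (A : Matrix (Fin (2*n)) (Fin (2*n)) ℝ) :
    (orbitTraces n A).Nonempty :=
  ⟨_, 1, by simp, rfl⟩

theorem mul_orthogonal {m : Type*} [Fintype m] [DecidableEq m] {P B : Matrix m m ℝ}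
    (hP : P * Pᵀ = 1) (hB : B * Bᵀ = 1) : (P * B) * (P * B)ᵀ = 1 := by
  rw [Matrix.transpose_mul, Matrix.mul_assoc, ← Matrix.mul_assoc B, hB, Matrix.one_mul, hP]

theorem diagonal_orthogonal {m : Type*} [Fintype m] [DecidableEq m] {d : m → ℝ}
    (hd : ∀ i, d i * d i = 1) : diagonal d * (diagonal d)ᵀ = 1 := by
  simp [Matrix.diagonal_mul_diagonal, hd]

theorem trace_conj_mul {m : Type*} [Fintype m] (P B A J : Matrix m m ℝ) :
    ((P * B) * A * (P * B)ᵀ * J).trace = (B * A * Bᵀ * (Pᵀ * J * P)).trace := by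
  rw [Matrix.transpose_mul]
  simp only [Matrix.mul_assoc]
  rw [Matrix.trace_mul_comm P]
  simp only [Matrix.mul_assoc]

theorem alternating_conj_stdJ (n : ℕ) :
    (diagonal fun i : Fin (2*n) => (-1 : ℝ) ^ (i : ℕ))ᵀ * stdJ n *
      (diagonal fun i : Fin (2*n) => (-1 : ℝ) ^ (i : ℕ)) = -stdJ n := by
  ext i j
  rw [Matrix.diagonal_transpose, Matrix.mul_diagonal, Matrix.diagonal_mul, Matrix.neg_apply]
  simp only [stdJ, Matrix.of_apply]
  split_ifs with h1 h2
  · rw [h1.1, pow_succ]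
    rcases neg_one_pow_eq_or ℝ (j : ℕ) with h | h <;> simp [h]
  · rw [h2.1, pow_succ]
    rcases neg_one_pow_eq_or ℝ (i : ℕ) with h | h <;> simp [h]
  · simp

theorem neg_mem_orbitTraces {n : ℕ} {A : Matrix (Fin (2*n)) (Fin (2*n)) ℝ} {x : ℝ}
    (hx : x ∈ orbitTraces n A) : -x ∈ orbitTraces n A := by
  obtain ⟨B, hB, rfl⟩ := hx
  refine ⟨(diagonal fun i : Fin (2*n) => (-1 : ℝ) ^ (i : ℕ)) * B,
    mul_orthogonal (diagonal_orthogonal fun i => ?_) hB, ?_⟩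
  · rw [← mul_pow]; simp
  · rw [trace_conj_mul, alternating_conj_stdJ, Matrix.mul_neg, Matrix.trace_neg]

open scoped Pointwise in
theorem orbitTraces_smul (n : ℕ) (c : ℝ) (A : Matrix (Fin (2*n)) (Fin (2*n)) ℝ) :
    orbitTraces n (c • A) = |c| • orbitTraces n A := by
  have key (B : Matrix (Fin (2*n)) (Fin (2*n)) ℝ) :
      (B * (c • A) * Bᵀ * stdJ n).trace = c * (B * A * Bᵀ * stdJ n).trace := by
    simp [Matrix.trace_smul]
  ext x
  rw [Set.mem_smul_set]
  constructor
  · rintro ⟨B, hB, rfl⟩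
    have hm : (B * A * Bᵀ * stdJ n).trace ∈ orbitTraces n A := ⟨B, hB, rfl⟩
    rcases abs_choice c with h | h
    · exact ⟨_, hm, by rw [h, key, smul_eq_mul]⟩
    · exact ⟨_, neg_mem_orbitTraces hm, by rw [h, key, smul_eq_mul, neg_mul_neg]⟩
  · rintro ⟨y, hy, rfl⟩
    rcases abs_choice c with h | h
    · obtain ⟨B, hB, rfl⟩ := hy
      exact ⟨B, hB, by rw [h, key, smul_eq_mul]⟩
    · obtain ⟨B, hB, hy⟩ := neg_mem_orbitTraces hy
      exact ⟨B, hB, by rw [h, key, ← hy, smul_eq_mul, neg_mul, mul_neg]⟩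

theorem orbitTraces_eq_zero {n : ℕ} {A : Matrix (Fin (2*n)) (Fin (2*n)) ℝ}
    (hA : nuNorm n A = 0) {x : ℝ} (hx : x ∈ orbitTraces n A) : x = 0 := by
  have hs : sSup (orbitTraces n A) = 0 := by
    rw [nuNorm_eq] at hA; linarith
  have h1 := le_csSup (orbitTraces_bddAbove n A) hx
  have h2 := le_csSup (orbitTraces_bddAbove n A) (neg_mem_orbitTraces hx)
  linarith

/-- Flipping the sign of the first coordinate changes `J_n` only in its first block. -/
theorem stdJ_sub_flip_conj {n : ℕ} (a b : Fin (2*n)) (ha : (a : ℕ) = 0) (hb : (b : ℕ) = 1) :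
    stdJ n - (diagonal fun i => if i = a then (-1 : ℝ) else 1)ᵀ * stdJ n *
      (diagonal fun i => if i = a then (-1 : ℝ) else 1) =
    Matrix.single b a 2 - Matrix.single a b 2 := by
  ext i j
  rw [Matrix.diagonal_transpose, Matrix.sub_apply, Matrix.mul_diagonal, Matrix.diagonal_mul]
  simp only [stdJ, Matrix.of_apply, Matrix.sub_apply, Matrix.single_apply, Fin.ext_iff, ha, hb]
  split_ifs <;> first | omega | norm_num

theorem exists_perm_apply_eq {α : Type*} [DecidableEq α] {a b i j : α} (hab : a ≠ b)
    (hij : i ≠ j) : ∃ σ : Equiv.Perm α, σ a = i ∧ σ b = j := by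
  refine ⟨(Equiv.swap b (Equiv.swap a i j)).trans (Equiv.swap a i), ?_, ?_⟩
  · have : a ≠ Equiv.swap a i j := fun h => hij <| by
      simpa using congrArg (Equiv.swap a i) h
    simp [Equiv.swap_apply_of_ne_of_ne hab this]
  · simp

theorem skew_eq_zero_of_nuNorm_eq_zero {n : ℕ} (hn : 1 ≤ n)
    {A : Matrix (Fin (2*n)) (Fin (2*n)) ℝ} (hA : Aᵀ = -A) (h0 : nuNorm n A = 0) : A = 0 := by
  have hskew (i j) : A j i = -A i j := by simpa using congrFun (congrFun hA i) j
  ext i j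
  rw [Matrix.zero_apply]
  by_cases hij : i = j
  · subst hij
    linarith [hskew i i]
  let a : Fin (2*n) := ⟨0, by omega⟩
  let b : Fin (2*n) := ⟨1, by omega⟩
  obtain ⟨σ, rfl, rfl⟩ := exists_perm_apply_eq (a := a) (b := b) (by simp [a, b]) hij
  let B : Matrix (Fin (2*n)) (Fin (2*n)) ℝ := (1 : Matrix _ _ ℝ).submatrix σ id
  have hconj (C : Matrix (Fin (2*n)) (Fin (2*n)) ℝ) : B * C * Bᵀ = C.submatrix σ σ := by
    ext k l
    simp [B, Matrix.mul_apply, Matrix.one_apply]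
  have hB : B * Bᵀ = 1 := by simpa using hconj 1
  have h1 := orbitTraces_eq_zero h0 ⟨B, hB, rfl⟩
  have h2 := orbitTraces_eq_zero h0
    ⟨(diagonal fun i => if i = a then (-1 : ℝ) else 1) * B,
      mul_orthogonal (diagonal_orthogonal fun i => by split_ifs <;> norm_num) hB, rfl⟩
  rw [trace_conj_mul] at h2
  have h3 : (B * A * Bᵀ * (Matrix.single b a 2 - Matrix.single a b 2)).trace = 0 := by
    rw [← stdJ_sub_flip_conj a b rfl rfl, Matrix.mul_sub, Matrix.trace_sub, h1, h2, sub_zero]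
  rw [hconj, Matrix.mul_sub, Matrix.trace_sub, Matrix.trace_mul_single,
    Matrix.trace_mul_single] at h3
  simp at h3
  linarith [hskew (σ a) (σ b)]

/-- `ν` is a norm on the space of skew-symmetric `2n × 2n` real matrices:
it is subadditive, absolutely homogeneous, and definite. -/
theorem nuNorm_is_norm (n : ℕ) (hn : 1 ≤ n) :
    (∀ A A' : Matrix (Fin (2*n)) (Fin (2*n)) ℝ, Aᵀ = -A → A'ᵀ = -A' →
        nuNorm n (A + A') ≤ nuNorm n A + nuNorm n A') ∧
    (∀ (c : ℝ) (A : Matrix (Fin (2*n)) (Fin (2*n)) ℝ), Aᵀ = -A →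
        nuNorm n (c • A) = |c| * nuNorm n A) ∧
    (∀ A : Matrix (Fin (2*n)) (Fin (2*n)) ℝ, Aᵀ = -A → nuNorm n A = 0 → A = 0) := by
  refine ⟨fun A A' _ _ => ?_, fun c A _ => ?_, fun A => skew_eq_zero_of_nuNorm_eq_zero hn⟩
  · simp only [nuNorm_eq]
    rw [← mul_add]
    refine mul_le_mul_of_nonneg_left (csSup_le (orbitTraces_nonempty n _) ?_) (by norm_num)
    rintro x ⟨B, hB, rfl⟩
    rw [Matrix.mul_add, Matrix.add_mul, Matrix.add_mul, Matrix.trace_add]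
    exact add_le_add (le_csSup (orbitTraces_bddAbove n A) ⟨B, hB, rfl⟩)
      (le_csSup (orbitTraces_bddAbove n A') ⟨B, hB, rfl⟩)
  · rw [nuNorm_eq, nuNorm_eq, orbitTraces_smul, Real.sSup_smul_of_nonneg (abs_nonneg c),
      smul_eq_mul]
    ring
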